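/- arXiv:1112.1295 — 5 statements merged into one kernel-verified Lean document; each statement's English description precedes it below -/
import Mathlib

section
/- Let a(m, o) denote the number of 0-1-2-increasing trees of size m having exactly o leaves (with a(m, 0) = 0). Then for all integers m ≥ 1 and o ≥ 1, a(m+1, o) = o·a(m, o) + (m − 2o + 3)·a(m, o−1). -/
/-- A 0-1-2-increasing tree of size `m`: vertices are `Fin m` (index `i`
represents label `i+1`, so index `0` is the root labelled `1`), encoded by a
parent function `f` with `f i < i` for every non-root vertex `i`
(and `f 0 = 0` by convention), such that every vertex has at most 2 children. -/
abbrev IncTree (m : ℕ) : Type :=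
  {f : Fin m → Fin m //
    (∀ i : Fin m, i.val = 0 → f i = i) ∧
    (∀ i : Fin m, i.val ≠ 0 → (f i).val < i.val) ∧
    (∀ j : Fin m, (Finset.univ.filter (fun i : Fin m => i.val ≠ 0 ∧ f i = j)).card ≤ 2)}

/-- The number of children of the vertex `j` in the tree `t`. -/
def numChildren {m : ℕ} (t : IncTree m) (j : Fin m) : ℕ :=
  (Finset.univ.filter (fun i : Fin m => i.val ≠ 0 ∧ t.val i = j)).card

/-- `o t`: the number of leaves (outdegree-0 vertices) of `t`. -/
def numLeaves {m : ℕ} (t : IncTree m) : ℕ :=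
  (Finset.univ.filter (fun j : Fin m => numChildren t j = 0)).card

/-- `a m o`: the number of 0-1-2-increasing trees of size `m` with exactly `o`
leaves (indexed by `o : ℤ` so that out-of-range values give `0`). -/
def countByLeaves (m : ℕ) (o : ℤ) : ℕ :=
  (Finset.univ.filter (fun t : IncTree m => (numLeaves t : ℤ) = o)).card

theorem nc_sum {m : ℕ} (t : IncTree m) (j : Fin m) :
    numChildren t j = ∑ i : Fin m, if (i.val ≠ 0 ∧ t.val i = j) then 1 else 0 := by
  unfold numChildren
  rw [Finset.card_filter]

theorem nl_sum {m : ℕ} (t : IncTree m) :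
    numLeaves t = ∑ j : Fin m, if numChildren t j = 0 then 1 else 0 := by
  unfold numLeaves
  rw [Finset.card_filter]

def extFun {m : ℕ} (f : Fin m → Fin m) (j : Fin m) : Fin (m + 1) → Fin (m + 1) :=
  Fin.snoc (α := fun _ => Fin (m + 1)) (fun i => (f i).castSucc) j.castSucc

theorem extFun_castSucc {m : ℕ} (f : Fin m → Fin m) (j i : Fin m) :
    extFun f j i.castSucc = (f i).castSucc := by
  simp [extFun]

theorem extFun_last {m : ℕ} (f : Fin m → Fin m) (j : Fin m) :
    extFun f j (Fin.last m) = j.castSucc := by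
  simp [extFun]

theorem extFun_sum {m : ℕ} (hm : 1 ≤ m) (f : Fin m → Fin m) (j k : Fin m) :
    (∑ i : Fin (m + 1), if (i.val ≠ 0 ∧ extFun f j i = k.castSucc) then 1 else 0) =
      (∑ i : Fin m, if (i.val ≠ 0 ∧ f i = k) then 1 else 0) + if k = j then 1 else 0 := by
  have h : m ≠ 0 := by omega
  rw [Fin.sum_univ_castSucc]
  simp [extFun_castSucc, extFun_last, h, eq_comm]

theorem extFun_sum_last {m : ℕ} (f : Fin m → Fin m) (j : Fin m) :
    (∑ i : Fin (m + 1), if (i.val ≠ 0 ∧ extFun f j i = Fin.last m) then 1 else 0) = 0 := by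
  rw [Fin.sum_univ_castSucc]
  simp [extFun_castSucc, extFun_last, Fin.castSucc_ne_last]

def ext {m : ℕ} (hm : 1 ≤ m) (p : Σ t : IncTree m, {j : Fin m // numChildren t j ≤ 1}) :
    IncTree (m + 1) :=
  ⟨extFun p.1.val p.2.val, by
    obtain ⟨t, j, hj⟩ := p
    refine ⟨?_, ?_, ?_⟩
    · intro i
      refine Fin.lastCases ?_ (fun i => ?_) i
      · intro h; simp at h; omega
      · intro h
        rw [extFun_castSucc, t.2.1 i (by simpa using h)]
    · intro i
      refine Fin.lastCases ?_ (fun i => ?_) i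
      · intro h; rw [extFun_last]; simp
      · intro h
        rw [extFun_castSucc]
        have := t.2.2.1 i (by simpa using h)
        simpa using this
    · intro k
      rw [Finset.card_filter]
      refine Fin.lastCases ?_ (fun k => ?_) k
      · rw [extFun_sum_last]; omega
      · rw [extFun_sum hm, ← nc_sum]
        dsimp only
        split_ifs with h
        · subst h; omega
        · exact t.2.2.2 k⟩

theorem nc_ext {m : ℕ} (hm : 1 ≤ m) (p : Σ t : IncTree m, {j : Fin m // numChildren t j ≤ 1})
    (k : Fin m) : numChildren (ext hm p) k.castSucc =
      numChildren p.1 k + if k = p.2.val then 1 else 0 := by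
  rw [nc_sum, nc_sum]; exact extFun_sum hm _ _ _

theorem nc_ext_last {m : ℕ} (hm : 1 ≤ m)
    (p : Σ t : IncTree m, {j : Fin m // numChildren t j ≤ 1}) :
    numChildren (ext hm p) (Fin.last m) = 0 := by
  rw [nc_sum]; exact extFun_sum_last _ _

theorem nl_ext {m : ℕ} (hm : 1 ≤ m)
    (p : Σ t : IncTree m, {j : Fin m // numChildren t j ≤ 1}) :
    numLeaves (ext hm p) = numLeaves p.1 + if numChildren p.1 p.2.val = 0 then 0 else 1 := by
  rw [nl_sum, nl_sum, Fin.sum_univ_castSucc]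
  simp only [nc_ext, nc_ext_last]
  rw [← Finset.add_sum_erase _ _ (Finset.mem_univ p.2.val),
    ← Finset.add_sum_erase (a := p.2.val) _ (fun j => if numChildren p.1 j = 0 then 1 else 0)
      (Finset.mem_univ p.2.val)]
  have : ∀ x ∈ Finset.univ.erase p.2.val,
      (if (numChildren p.1 x + if x = p.2.val then 1 else 0) = 0 then 1 else 0) =
      (if numChildren p.1 x = 0 then 1 else 0) := by
    intro x hx
    simp [Finset.ne_of_mem_erase hx]
  rw [Finset.sum_congr rfl this]
  by_cases h : numChildren p.1 p.2.val = 0 <;> simp [h] <;> omega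

theorem ext_bij {m : ℕ} (hm : 1 ≤ m) : Function.Bijective (ext (m := m) hm) := by
  constructor
  · rintro ⟨⟨t, ht⟩, j, hj⟩ ⟨⟨t', ht'⟩, j', hj'⟩ h
    have h1 : extFun t j = extFun t' j' := congrArg Subtype.val h
    have e1 : t = t' := by
      funext i
      have := congrFun h1 i.castSucc
      rw [extFun_castSucc, extFun_castSucc] at this
      exact Fin.castSucc_injective _ this
    have e2 : j = j' := by
      have := congrFun h1 (Fin.last m)
      rw [extFun_last, extFun_last] at this
      exact Fin.castSucc_injective _ this
    subst e1; subst e2; rfl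
  · intro T
    have hlt : ∀ i : Fin m, (T.val i.castSucc).val < m := by
      intro i
      by_cases h : i.val = 0
      · rw [T.2.1 i.castSucc (by simpa using h)]; simp
      · have := T.2.2.1 i.castSucc (by simpa using h)
        simp at this; omega
    have hl : (T.val (Fin.last m)).val < m := by
      have := T.2.2.1 (Fin.last m) (by simp; omega)
      simpa using this
    let f : Fin m → Fin m := fun i => ⟨_, hlt i⟩
    let j : Fin m := ⟨_, hl⟩
    have hf : T.val = extFun f j := by
      funext i
      refine Fin.lastCases ?_ (fun i => ?_) i
      · rw [extFun_last]; rfl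
      · rw [extFun_castSucc]; rfl
    have hc : ∀ k, (∑ i : Fin m, if (i.val ≠ 0 ∧ f i = k) then 1 else 0) +
        (if k = j then 1 else 0) ≤ 2 := by
      intro k
      rw [← extFun_sum hm, ← hf, ← Finset.card_filter]
      exact T.2.2.2 k.castSucc
    let t : IncTree m := ⟨f, by
      refine ⟨?_, ?_, ?_⟩
      · intro i h
        apply Fin.ext
        have := T.2.1 i.castSucc (by simpa using h)
        simpa using congrArg Fin.val this
      · intro i h
        have := T.2.2.1 i.castSucc (by simpa using h)
        exact this
      · intro k
        rw [Finset.card_filter]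
        exact le_trans (Nat.le_add_right _ _) (hc k)⟩
    refine ⟨⟨t, j, ?_⟩, Subtype.ext hf.symm⟩
    rw [nc_sum]
    have := hc j
    rw [if_pos rfl] at this
    exact Nat.le_of_succ_le_succ this

theorem sum_nc {m : ℕ} (hm : 1 ≤ m) (t : IncTree m) :
    ∑ j : Fin m, numChildren t j + 1 = m := by
  simp only [nc_sum]
  rw [Finset.sum_comm]
  obtain ⟨n, rfl⟩ : ∃ n, m = n + 1 := ⟨m - 1, by omega⟩
  rw [Fin.sum_univ_succ]
  simp

theorem ones {m : ℕ} (hm : 1 ≤ m) (t : IncTree m) :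
    (∑ j : Fin m, if numChildren t j = 1 then (1 : ℤ) else 0) = m + 1 - 2 * numLeaves t := by
  have h1 : ((∑ j : Fin m, numChildren t j + 1 : ℕ) : ℤ) = m := by rw [sum_nc hm t]
  have h3 : ∑ j : Fin m, (1 : ℤ) = m := by simp
  have h2 : ∀ j : Fin m, (if numChildren t j = 1 then (1 : ℤ) else 0) =
      2 - 2 * (if numChildren t j = 0 then 1 else 0) - numChildren t j := by
    intro j
    have : numChildren t j ≤ 2 := t.2.2.2 j
    interval_cases numChildren t j <;> simp
  rw [Finset.sum_congr rfl (fun j _ => h2 j), nl_sum, Finset.sum_sub_distrib,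
    Finset.sum_sub_distrib, ← Finset.mul_sum]
  push_cast at h1 ⊢
  simp
  linarith

theorem count_sum (m : ℕ) (o : ℤ) :
    (countByLeaves m o : ℤ) = ∑ t : IncTree m, if (numLeaves t : ℤ) = o then 1 else 0 := by
  unfold countByLeaves
  rw [Finset.card_filter]; push_cast; rfl

theorem fiber {m : ℕ} (hm : 1 ≤ m) (o : ℤ) (t : IncTree m) :
    (∑ j : {j : Fin m // numChildren t j ≤ 1},
      if (numLeaves (ext hm ⟨t, j⟩) : ℤ) = o then (1 : ℤ) else 0) =
    o * (if (numLeaves t : ℤ) = o then 1 else 0) +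
      ((m : ℤ) - 2 * o + 3) * (if (numLeaves t : ℤ) = o - 1 then 1 else 0) := by
  simp only [nl_ext]
  rw [← Finset.sum_subtype (Finset.univ.filter fun j : Fin m => numChildren t j ≤ 1)
    (by simp) (fun j => if ((numLeaves t + if numChildren t j = 0 then 0 else 1 : ℕ) : ℤ) = o
      then (1 : ℤ) else 0), Finset.sum_filter]
  have h : ∀ j : Fin m, (if numChildren t j ≤ 1 then
      (if ((numLeaves t + if numChildren t j = 0 then 0 else 1 : ℕ) : ℤ) = o
      then (1 : ℤ) else 0) else 0) =
      (if numChildren t j = 0 then 1 else 0) * (if (numLeaves t : ℤ) = o then 1 else 0) +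
      (if numChildren t j = 1 then 1 else 0) * (if (numLeaves t : ℤ) = o - 1 then 1 else 0) := by
    intro j
    have : numChildren t j ≤ 2 := t.2.2.2 j
    have e : (numLeaves t : ℤ) + 1 = o ↔ (numLeaves t : ℤ) = o - 1 := by omega
    interval_cases numChildren t j <;> simp [e]
  have hz : (∑ j : Fin m, if numChildren t j = 0 then (1 : ℤ) else 0) = numLeaves t := by
    rw [nl_sum]; push_cast; rfl
  rw [Finset.sum_congr rfl (fun j _ => h j), Finset.sum_add_distrib, ← Finset.sum_mul,
    ← Finset.sum_mul, ones hm, hz]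
  congr 1
  · split_ifs with h
    · rw [h]
    · simp
  · split_ifs with h
    · rw [h]; ring
    · simp

/-- The succession rule `(o,m) → (o,m+1)^o (o+1,m+1)^(m-2o+1)`:
`a(m+1, o) = o·a(m, o) + (m − 2o + 3)·a(m, o−1)` for `m ≥ 1`, `o ≥ 1`. -/
theorem countByLeaves_recursion (m : ℕ) (hm : 1 ≤ m) (o : ℤ) (ho : 1 ≤ o) :
    (countByLeaves (m + 1) o : ℤ) =
      o * countByLeaves m o + ((m : ℤ) - 2 * o + 3) * countByLeaves m (o - 1) := by
  simp only [count_sum]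
  rw [← (Equiv.ofBijective _ (ext_bij hm)).sum_comp, Fintype.sum_sigma, Finset.mul_sum,
    Finset.mul_sum, ← Finset.sum_add_distrib]
  exact Finset.sum_congr rfl (fun t _ => fiber hm o t)
end

section
/- For every real z with |z| < π/2, the series Σ_{m ≥ 1} |I_m| z^m / m! converges and its sum equals (1 + sin z)/cos z − 1, where |I_m| is the number of 0-1-2-increasing trees of size m. (Equivalently, the exponential generating function of 0-1-2-increasing trees is sec z + tan z − 1.) -/
open Real

/-- parent sequences -/
abbrev PSeq (m : ℕ) : Type := ∀ i : Fin m, Fin (i.val + 1)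

def pcnt {m : ℕ} (p : PSeq m) (j : ℕ) : ℕ := ∑ i : Fin m, if (p i).val = j then 1 else 0

noncomputable def gw (b : ℂ) : ℕ → ℂ
  | 0 => (1 + b ^ 2) / 2
  | 1 => b
  | 2 => 1
  | _ => 0

noncomputable def FF (m : ℕ) (b : ℂ) : ℂ := ∑ p : PSeq m, ∏ j ∈ Finset.range (m + 1), gw b (pcnt p j)

lemma gw_one (n : ℕ) : gw 1 n = if n ≤ 2 then 1 else 0 := by
  rcases n with _ | _ | _ | n
  · norm_num [gw]
  · norm_num [gw]
  · norm_num [gw]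
  · rw [if_neg (by omega)]
    rfl

lemma pcnt_big {m : ℕ} (p : PSeq m) : pcnt p m = 0 := by
  unfold pcnt
  apply Finset.sum_eq_zero
  intro i _
  have := (p i).isLt
  have := i.isLt
  rw [if_neg (by omega)]

lemma pcnt_big' {m : ℕ} (p : PSeq m) : pcnt p (m + 1) = 0 := by
  unfold pcnt
  apply Finset.sum_eq_zero
  intro i _
  have := (p i).isLt
  have := i.isLt
  rw [if_neg (by omega)]

lemma pcnt_snoc {m : ℕ} (p : PSeq m) (x : Fin (m + 1)) (j : ℕ) :
    pcnt (Fin.snocEquiv (fun i : Fin (m + 1) => Fin (i.val + 1)) (x, p)) j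
      = pcnt p j + if x.val = j then 1 else 0 := by
  unfold pcnt
  rw [Fin.sum_univ_castSucc]
  simp [Fin.snocEquiv]

lemma FF_succ (m : ℕ) (b : ℂ) : FF (m + 1) b = ∑ p : PSeq m, ∑ x ∈ Finset.range (m + 1),
    (∏ j ∈ (Finset.range (m + 1)).erase x, gw b (pcnt p j)) *
      (gw b (pcnt p x + 1) * ((1 + b ^ 2) / 2)) := by
  unfold FF
  rw [← (Fin.snocEquiv (fun i : Fin (m + 1) => Fin (i.val + 1))).sum_comp,
    Fintype.sum_prod_type_right]
  refine Finset.sum_congr rfl fun p _ => ?_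
  rw [Finset.sum_range]
  refine Finset.sum_congr rfl fun x _ => ?_
  have hx : x.val < m + 1 := x.isLt
  rw [Finset.prod_range_succ]
  simp only [pcnt_snoc]
  rw [← Finset.prod_erase_mul _ _ (Finset.mem_range.2 hx), if_pos rfl, pcnt_big',
    if_neg (show ¬ x.val = m + 1 from (Nat.ne_of_lt hx)),
    mul_assoc]
  congr 1
  refine Finset.prod_congr rfl fun j hj => ?_
  rw [if_neg (Ne.symm (Finset.ne_of_mem_erase hj)), add_zero]

lemma gw_deriv {y : ℂ → ℂ} {z : ℂ} (h : HasDerivAt y ((1 + y z ^ 2) / 2) z) (n : ℕ) :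
    HasDerivAt (fun z => gw (y z) n) (gw (y z) (n + 1) * ((1 + y z ^ 2) / 2)) z := by
  rcases n with _ | _ | _ | n
  · have := ((h.pow 2).const_add 1).div_const 2
    simp only [gw]
    convert! this using 1
    simp
    ring
  · simpa [gw] using h
  · simpa [gw] using hasDerivAt_const z (1 : ℂ)
  · simpa [gw] using hasDerivAt_const z (0 : ℂ)

lemma FF_deriv {y : ℂ → ℂ} {z : ℂ} (h : HasDerivAt y ((1 + y z ^ 2) / 2) z) (m : ℕ) :
    HasDerivAt (fun z => FF m (y z)) (FF (m + 1) (y z)) z := by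
  rw [FF_succ]
  unfold FF
  apply HasDerivAt.fun_sum
  intro p _
  exact HasDerivAt.fun_finsetProd (fun i _ => gw_deriv h (pcnt p i))

lemma FF_zero (b : ℂ) : FF 0 b = (1 + b ^ 2) / 2 := by
  simp [FF, pcnt, gw]

lemma iter_eq {y : ℂ → ℂ} {s : Set ℂ} (hs : IsOpen s)
    (h : ∀ z ∈ s, HasDerivAt y ((1 + y z ^ 2) / 2) z) (m : ℕ) :
    ∀ z ∈ s, iteratedDeriv (m + 1) y z = FF m (y z) := by
  induction m with
  | zero => intro z hz; rw [zero_add, iteratedDeriv_one, FF_zero]; exact (h z hz).deriv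
  | succ m ih =>
    intro z hz
    rw [iteratedDeriv_succ]
    have : iteratedDeriv (m + 1) y =ᶠ[nhds z] fun z => FF m (y z) := by
      filter_upwards [hs.mem_nhds hz] with w hw using ih w hw
    rw [this.deriv_eq]
    exact (FF_deriv (h z hz) m).deriv

lemma pcnt_tree {m : ℕ} (p : PSeq m) (f : Fin (m + 1) → Fin (m + 1))
    (h : ∀ i : Fin m, (f i.succ).val = (p i).val) (j : Fin (m + 1)) :
    (Finset.univ.filter (fun i : Fin (m + 1) => i.val ≠ 0 ∧ f i = j)).card = pcnt p j := by
  rw [Finset.card_filter, Fin.sum_univ_succ]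
  simp [pcnt, Fin.ext_iff, h]

def treeEquiv (m : ℕ) : IncTree (m + 1) ≃ {p : PSeq m // ∀ j < m + 1, pcnt p j ≤ 2} where
  toFun t := ⟨fun i => ⟨(t.1 i.succ).val, by simpa using t.2.2.1 i.succ (by simp)⟩, by
    intro j hj
    rw [← pcnt_tree _ t.1 (fun i => rfl) ⟨j, hj⟩]
    exact t.2.2.2 _⟩
  invFun p := ⟨Fin.cons 0 (fun i => ⟨(p.1 i).val, by have := (p.1 i).isLt; omega⟩), by
    refine ⟨?_, ?_, ?_⟩
    · intro i hi
      have : i = 0 := Fin.ext hi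
      subst this
      rfl
    · intro i
      refine Fin.cases ?_ ?_ i
      · simp
      · intro i _
        simp only [Fin.cons_succ, Fin.val_succ]
        exact (p.1 i).isLt
    · intro j
      rw [pcnt_tree p.1 _ (fun i => by simp)]
      exact p.2 _ j.isLt⟩
  left_inv t := by
    apply Subtype.ext
    funext i
    refine Fin.cases ?_ ?_ i
    · exact (t.2.1 0 rfl).symm
    · intro i
      simp
  right_inv p := by
    apply Subtype.ext
    funext i
    simp

lemma FF_one (m : ℕ) : FF m 1 = (Fintype.card (IncTree (m + 1)) : ℂ) := by
  classical
  rw [Fintype.card_congr (treeEquiv m), Fintype.card_subtype, Finset.card_filter]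
  push_cast
  unfold FF
  refine Finset.sum_congr rfl fun p _ => ?_
  simp only [gw_one]
  rw [Finset.prod_ite_zero]
  simp

lemma cos_ne {z : ℂ} (hz : z ∈ Metric.ball (0 : ℂ) (Real.pi / 2)) : Complex.cos z ≠ 0 := by
  intro h
  obtain ⟨k, hk⟩ := Complex.cos_eq_zero_iff.1 h
  rw [mem_ball_zero_iff, hk] at hz
  have h2 : ((2 * (k : ℂ) + 1) * (Real.pi : ℂ) / 2) = (((2 * k + 1 : ℤ) : ℝ) * (Real.pi / 2) : ℝ) := by
    push_cast; ring
  rw [h2, Complex.norm_real, Real.norm_eq_abs, abs_mul, abs_of_pos (a := Real.pi / 2) (by positivity)] at hz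
  have h3 : (1 : ℝ) ≤ |((2 * k + 1 : ℤ) : ℝ)| := by
    rw [← Int.cast_abs]
    exact_mod_cast Int.one_le_abs (by omega)
  nlinarith [Real.pi_pos]

lemma y_deriv {z : ℂ} (hz : Complex.cos z ≠ 0) :
    HasDerivAt (fun z => (1 + Complex.sin z) / Complex.cos z)
      ((1 + ((1 + Complex.sin z) / Complex.cos z) ^ 2) / 2) z := by
  have := ((Complex.hasDerivAt_sin z).const_add 1).div (Complex.hasDerivAt_cos z) hz
  convert! this using 1
  have h := Complex.sin_sq_add_cos_sq z
  field_simp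
  linear_combination (-1 : ℂ) * h

/-- For `|z| < π/2`, the exponential generating function of 0-1-2-increasing
trees, `Σ_{m ≥ 1} |I_m| z^m / m!`, converges to `sec z + tan z − 1
= (1 + sin z)/cos z − 1`. -/
theorem egf_incTree (z : ℝ) (hz : |z| < π / 2) :
    HasSum (fun m : ℕ =>
        (Fintype.card (IncTree (m + 1)) : ℝ) * z ^ (m + 1) / (Nat.factorial (m + 1)))
      ((1 + Real.sin z) / Real.cos z - 1) := by
  set y : ℂ → ℂ := fun z => (1 + Complex.sin z) / Complex.cos z with hy
  have hd : ∀ w ∈ Metric.ball (0 : ℂ) (π / 2), HasDerivAt y ((1 + y w ^ 2) / 2) w :=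
    fun w hw => y_deriv (cos_ne hw)
  have hy0 : y 0 = 1 := by simp [hy]
  have hzb : (z : ℂ) ∈ Metric.ball (0 : ℂ) (π / 2) := by
    simpa using hz
  have h0 : (0 : ℂ) ∈ Metric.ball (0 : ℂ) (π / 2) := Metric.mem_ball_self (by positivity)
  have H := Complex.hasSum_taylorSeries_on_ball
    (fun w hw => (hd w hw).differentiableAt.differentiableWithinAt) hzb
  rw [← hasSum_nat_add_iff' 1] at H
  rw [← Complex.hasSum_ofReal]
  convert! H using 1
  · funext m
    rw [iter_eq Metric.isOpen_ball hd m 0 h0, hy0, FF_one]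
    push_cast
    simp only [smul_eq_mul, sub_zero]
    ring
  · simp [hy]
end

section
/- Fix a real number x with 0 < x < 1/2 and set s = √(1 − 2x). Then there exists ε > 0 such that for every real z with |z| < ε, the series Σ_{m ≥ 1} (Σ_{t ∈ I_m} x^{o(t)}) z^m / m! converges and its sum equals 2x(e^{sz} − 1) / ((s − 1)e^{sz} + s + 1). -/
open Real


namespace IncAux

/-- parent functions of recursive trees on `n+1` vertices -/
abbrev Par (n : ℕ) : Type := (i : Fin n) → Fin (i.val + 1)

/-- number of children -/
def cc {n : ℕ} (g : Par n) (j : ℕ) : ℕ := ∑ i : Fin n, if (g i).val = j then 1 else 0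

/-- total weight -/
def tot (w : ℕ → ℝ) (n : ℕ) : ℝ := ∑ g : Par n, ∏ j : Fin (n + 1), w (cc g j.val)

lemma tot_succ (w : ℕ → ℝ) (n : ℕ) :
    tot w (n + 1) = ∑ g : Par n, ∑ p : Fin (n + 1),
      w 0 * ∏ j : Fin (n + 1), w (cc g j.val + if p = j then 1 else 0) := by
  unfold tot
  rw [← (Fin.snocEquiv (fun i : Fin (n + 1) => Fin (i.val + 1))).sum_comp,
    Fintype.sum_prod_type, Finset.sum_comm]
  refine Finset.sum_congr rfl fun g _ => Finset.sum_congr rfl fun p _ => ?_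
  rw [Fin.prod_univ_castSucc, mul_comm]
  congr 1
  · congr 1
    simp only [cc, Fin.sum_univ_castSucc, Fin.snocEquiv, Equiv.coe_fn_mk, Fin.snoc_castSucc,
      Fin.snoc_last, Fin.val_last]
    rw [if_neg (by have := p.isLt; simp at this; omega), add_zero]
    refine Finset.sum_eq_zero fun i _ => if_neg ?_
    have := (g i).isLt
    have := i.isLt
    simp at *
    omega
  · refine Finset.prod_congr rfl fun j _ => ?_
    congr 1
    simp only [cc, Fin.sum_univ_castSucc, Fin.snocEquiv, Equiv.coe_fn_mk, Fin.snoc_castSucc,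
      Fin.snoc_last]
    congr 1
    simp [Fin.ext_iff]

lemma tot_hasDerivAt (w : ℝ → ℕ → ℝ) (z : ℝ)
    (hw : ∀ k, HasDerivAt (fun z => w z k) (w z (k + 1) * w z 0) z) (n : ℕ) :
    HasDerivAt (fun z => tot (w z) n) (tot (w z) (n + 1)) z := by
  rw [tot_succ]
  unfold tot
  refine HasDerivAt.fun_sum (A := fun (g : Par n) z => ∏ j : Fin (n + 1), w z (cc g j.val)) fun g _ => ?_
  have h := HasDerivAt.fun_finsetProd (u := (Finset.univ : Finset (Fin (n+1))))
    (f := fun j z => w z (cc g j.val)) (fun j _ => hw (cc g j.val))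
  convert! h using 1
  refine Finset.sum_congr rfl fun p _ => ?_
  rw [← Finset.mul_prod_erase Finset.univ _ (Finset.mem_univ p), smul_eq_mul]
  have : ∏ j ∈ Finset.univ.erase p, w z (cc g j.val + if p = j then 1 else 0)
      = ∏ j ∈ Finset.univ.erase p, w z (cc g j.val) := by
    refine Finset.prod_congr rfl fun j hj => ?_
    rw [if_neg (fun h => (Finset.ne_of_mem_erase hj) h.symm), add_zero]
  rw [this, if_pos rfl]
  ring

/-- parent function of a tree -/
def toPar {n : ℕ} (t : IncTree (n + 1)) : Par n := fun i =>
  ⟨(t.val i.succ).val, by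
    have := t.2.2.1 i.succ (by simp)
    simpa using this⟩

/-- function from parent data -/
def ofPar {n : ℕ} (g : Par n) : Fin (n + 1) → Fin (n + 1) :=
  Fin.cases 0 (fun i => ⟨(g i).val, by have := (g i).isLt; have := i.isLt; omega⟩)

lemma card_children {n : ℕ} (f : Fin (n + 1) → Fin (n + 1)) (g : Par n)
    (h : ∀ i : Fin n, (f i.succ).val = (g i).val) (j : Fin (n + 1)) :
    (Finset.univ.filter (fun i : Fin (n + 1) => i.val ≠ 0 ∧ f i = j)).card = cc g j.val := by
  rw [Finset.card_filter, Fin.sum_univ_succ]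
  simp [cc, Fin.ext_iff, h]

lemma tot_eq (x : ℝ) (w : ℕ → ℝ) (h0 : w 0 = x) (h1 : w 1 = 1) (h2 : w 2 = 1)
    (h3 : ∀ k, 3 ≤ k → w k = 0) (n : ℕ) :
    ∑ t : IncTree (n + 1), x ^ numLeaves t = tot w n := by
  unfold tot
  have hz : ∀ g : Par n, g ∉ Finset.univ.filter (fun g : Par n => ∀ j : Fin (n+1), cc g j.val ≤ 2) →
      ∏ j : Fin (n + 1), w (cc g j.val) = 0 := by
    intro g hg
    simp only [Finset.mem_filter, Finset.mem_univ, true_and, not_forall] at hg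
    obtain ⟨j, hj⟩ := hg
    exact Finset.prod_eq_zero (Finset.mem_univ j) (h3 _ (by omega))
  rw [← Finset.sum_subset (Finset.subset_univ
    (Finset.univ.filter (fun g : Par n => ∀ j : Fin (n+1), cc g j.val ≤ 2)))
    (fun g _ hg => hz g hg)]
  refine Finset.sum_bij (fun t _ => toPar t) ?_ ?_ ?_ ?_
  · intro t _
    simp only [Finset.mem_filter, Finset.mem_univ, true_and]
    intro j
    rw [← card_children t.val (toPar t) (fun i => rfl) j]
    exact t.2.2.2 j
  · intro t _ t' _ h
    apply Subtype.ext
    funext i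
    refine Fin.cases ?_ (fun i => ?_) i
    · rw [t.2.1 0 rfl, t'.2.1 0 rfl]
    · have := congrFun h i
      simpa [toPar, Fin.ext_iff] using this
  · intro g hg
    simp only [Finset.mem_filter, Finset.mem_univ, true_and] at hg
    refine ⟨⟨ofPar g, ?_, ?_, ?_⟩, Finset.mem_univ _, ?_⟩
    · intro i hi
      have : i = 0 := Fin.ext hi
      subst this
      rfl
    · intro i
      refine Fin.cases (fun h => absurd rfl h) (fun i _ => ?_) i
      simpa [ofPar] using (g i).isLt
    · intro j
      rw [card_children (ofPar g) g (fun i => rfl) j]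
      exact hg j
    · funext i
      rfl
  · intro t _
    have hc : ∀ j : Fin (n+1), numChildren t j = cc (toPar t) j.val := fun j =>
      card_children t.val (toPar t) (fun i => rfl) j
    have hle : ∀ j : Fin (n+1), numChildren t j ≤ 2 := t.2.2.2
    unfold numLeaves
    rw [← Finset.prod_const, Finset.prod_filter]
    refine Finset.prod_congr rfl fun j _ => ?_
    rw [← hc j]
    have := hle j
    generalize numChildren t j = k at this ⊢
    interval_cases k <;> simp [h0, h1, h2]

/-- weights -/
noncomputable def wt (x y : ℝ) : ℕ → ℝ
  | 0 => x + y + y ^ 2 / 2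
  | 1 => 1 + y
  | 2 => 1
  | _ => 0

lemma wt_deriv (x : ℝ) (F : ℝ → ℝ) (z : ℝ) (hF : HasDerivAt F (x + F z + F z ^ 2 / 2) z) (k : ℕ) :
    HasDerivAt (fun z => wt x (F z) k) (wt x (F z) (k + 1) * wt x (F z) 0) z := by
  match k with
  | 0 =>
    simp only [wt]
    convert! (hF.const_add x).add ((hF.pow 2).div_const 2) using 1
    simp
    ring
  | 1 =>
    simp only [wt]
    convert! hF.const_add 1 using 1
    ring
  | 2 => simpa [wt] using hasDerivAt_const z (1:ℝ)
  | k + 3 => simpa [wt] using hasDerivAt_const z (0:ℝ)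

lemma iter (x : ℝ) (F : ℝ → ℝ) (U : Set ℝ) (hU : IsOpen U)
    (hF : ∀ z ∈ U, HasDerivAt F (x + F z + F z ^ 2 / 2) z) (n : ℕ) :
    ∀ z ∈ U, iteratedDeriv (n + 1) F z = tot (wt x (F z)) n := by
  induction n with
  | zero =>
    intro z hz
    rw [iteratedDeriv_one, (hF z hz).deriv]
    simp [tot, cc, wt]
  | succ n ih =>
    intro z hz
    rw [iteratedDeriv_succ]
    have : iteratedDeriv (n + 1) F =ᶠ[nhds z] fun z => tot (wt x (F z)) n :=
      Filter.eventually_of_mem (hU.mem_nhds hz) ih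
    rw [this.deriv_eq]
    exact (tot_hasDerivAt (fun z => wt x (F z)) z (wt_deriv x F z (hF z hz)) n).deriv

end IncAux

/-- For fixed `0 < x < 1/2` and `s = √(1 − 2x)`, the bivariate EGF
`Y(x,z) = Σ_{m ≥ 1} (Σ_{t ∈ I_m} x^{o t}) z^m / m!` converges for `z` small
enough, with sum `2x(e^{sz} − 1) / ((s − 1)e^{sz} + s + 1)`. -/
theorem egf_incTree_leaves_exp (x : ℝ) (hx0 : 0 < x) (hx1 : x < 1 / 2) :
    ∃ ε > 0, ∀ z : ℝ, |z| < ε →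
      HasSum (fun m : ℕ =>
          (∑ t : IncTree (m + 1), x ^ numLeaves t) * z ^ (m + 1) /
            (Nat.factorial (m + 1)))
        (2 * x * (Real.exp (Real.sqrt (1 - 2 * x) * z) - 1) /
          ((Real.sqrt (1 - 2 * x) - 1) * Real.exp (Real.sqrt (1 - 2 * x) * z)
            + Real.sqrt (1 - 2 * x) + 1)) := by
  have hs : 0 < Real.sqrt (1 - 2 * x) := Real.sqrt_pos.2 (by linarith)
  have hs2 : Real.sqrt (1 - 2 * x) ^ 2 = 1 - 2 * x := Real.sq_sqrt (by linarith)
  generalize Real.sqrt (1 - 2 * x) = s at hs hs2 ⊢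
  set D : ℝ → ℝ := fun z => (s - 1) * Real.exp (s * z) + s + 1 with hD
  set F : ℝ → ℝ := fun z => 2 * x * (Real.exp (s * z) - 1) / D z with hFdef
  have hDc : Continuous D := by fun_prop
  have hU : IsOpen {z | D z ≠ 0} := isOpen_ne_fun hDc continuous_const
  have hD0 : D 0 ≠ 0 := by simp [hD]; linarith
  have hF0 : F 0 = 0 := by simp [hFdef]
  have hFd : ∀ z ∈ {z | D z ≠ 0}, HasDerivAt F (x + F z + F z ^ 2 / 2) z := by
    intro z hz
    have hz' : D z ≠ 0 := hz
    have he : HasDerivAt (fun z => Real.exp (s * z)) (Real.exp (s * z) * s) z := by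
      simpa using ((hasDerivAt_id z).const_mul s).exp
    have hDd : HasDerivAt D ((s - 1) * (Real.exp (s * z) * s)) z :=
      ((he.const_mul (s - 1)).add_const s).add_const 1
    have := ((he.sub_const 1).const_mul (2 * x)).div hDd hz'
    convert! this using 1
    simp only [hFdef]
    have hx : x = (1 - s ^ 2) / 2 := by linarith
    field_simp
    simp only [hD]
    rw [hx]
    ring
  have hA : AnalyticAt ℝ F 0 := by
    refine AnalyticAt.div ?_ ?_ hD0
    · fun_prop
    · fun_prop
  have h1 := hasFPowerSeriesAt_iff'.1 hA.hasFPowerSeriesAt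
  obtain ⟨ε, hε, h⟩ := Metric.eventually_nhds_iff.1 h1
  refine ⟨ε, hε, fun z hz => ?_⟩
  have h2 := h (y := z) (by simpa using hz)
  rw [← hasSum_nat_add_iff' 1] at h2
  simp only [FormalMultilinearSeries.coeff_ofScalars, sub_zero, Finset.sum_range_one,
    iteratedDeriv_zero, hF0, zero_div, smul_zero] at h2
  convert! h2 using 1
  funext m
  rw [IncAux.iter x F _ hU hFd m 0 hD0, hF0,
    IncAux.tot_eq x (IncAux.wt x 0) (by simp [IncAux.wt]) (by simp [IncAux.wt]) rfl
      (fun k hk => by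
        obtain ⟨k, rfl⟩ := Nat.exists_eq_add_of_le' hk
        rfl) m, smul_eq_mul]
  ring
end

section
/- Fix a real number x with 1/2 < x ≤ 1 and set s = √(2x − 1). Then there exists ε > 0 such that for every real z with |z| < ε, one has tan(arctan s − z·s/2) ≠ 0, the series Σ_{m ≥ 1} (Σ_{t ∈ I_m} x^{o(t)}) z^m / m! converges, and its sum equals s / tan(arctan s − z·s/2) − 1. -/
open Real

/-- Unrestricted recursive trees: `r i` is the parent of vertex `i+1`. -/
abbrev RecT (m : ℕ) : Type := ∀ i : Fin m, Fin (i.val + 1)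

def rcnt {m : ℕ} (r : RecT m) (j : ℕ) : ℕ := ∑ i : Fin m, if (r i).val = j then 1 else 0

def wt (a b : ℝ) (k : ℕ) : ℝ := if k = 0 then a else if k = 1 then b else if k = 2 then 1 else 0

def WW (a b : ℝ) (m : ℕ) : ℝ :=
  ∑ r : RecT m, ∏ j : Fin (m + 1), wt a b (rcnt r j.val)

lemma rcnt_top {m : ℕ} (r : RecT m) (j : ℕ) (h : m ≤ j) : rcnt r j = 0 := by
  unfold rcnt
  apply Finset.sum_eq_zero
  intro i _
  have := (r i).isLt
  have := i.isLt
  rw [if_neg (by omega)]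

lemma WW_succ (a b : ℝ) (m : ℕ) :
    WW a b (m + 1) = ∑ r : RecT m, ∑ p : Fin (m + 1),
      a * ∏ j : Fin (m + 1), wt a b (rcnt r j.val + if p = j then 1 else 0) := by
  unfold WW
  have e := (Fin.snocEquiv (fun i : Fin (m + 1) => Fin (i.val + 1)))
  rw [← Equiv.sum_comp (Fin.snocEquiv (fun i : Fin (m + 1) => Fin (i.val + 1))),
    Fintype.sum_prod_type_right]
  refine Finset.sum_congr rfl fun r _ => Finset.sum_congr rfl fun p _ => ?_
  have key : ∀ j : ℕ, rcnt (m := m + 1)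
      ((Fin.snocEquiv (fun i : Fin (m + 1) => Fin (i.val + 1))) (p, r)) j
      = rcnt (m := m) r j + if p.val = j then 1 else 0 := by
    intro j
    unfold rcnt
    rw [Fin.sum_univ_castSucc]
    simp [Fin.snocEquiv]
  rw [Fin.prod_univ_castSucc, mul_comm]
  congr 1
  · rw [key, rcnt_top]
    · have : p.val < m + 1 := p.isLt
      rw [if_neg (by simp; omega)]
      simp [wt]
    · simp
  · refine Finset.prod_congr rfl fun j _ => ?_
    rw [key]
    have : (p.val = (j.castSucc).val) ↔ p = j := by
      rw [Fin.val_castSucc]; exact Fin.ext_iff.symm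
    simp only [this]
    rfl

lemma wt_deriv (a b : ℝ → ℝ) (z : ℝ) (ha : HasDerivAt a (a z * b z) z)
    (hb : HasDerivAt b (a z) z) (k : ℕ) :
    HasDerivAt (fun y => wt (a y) (b y) k) (a z * wt (a z) (b z) (k + 1)) z := by
  match k with
  | 0 => simpa [wt] using ha
  | 1 => simpa [wt] using hb
  | 2 => simpa [wt] using hasDerivAt_const z (1:ℝ)
  | k + 3 => simpa [wt] using hasDerivAt_const z (0:ℝ)

lemma WW_deriv (a b : ℝ → ℝ) (z : ℝ) (ha : HasDerivAt a (a z * b z) z)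
    (hb : HasDerivAt b (a z) z) (m : ℕ) :
    HasDerivAt (fun y => WW (a y) (b y) m) (WW (a z) (b z) (m + 1)) z := by
  rw [WW_succ]
  unfold WW
  refine HasDerivAt.fun_sum fun r _ => ?_
  have := HasDerivAt.fun_finsetProd (u := Finset.univ)
    (f := fun (j : Fin (m+1)) y => wt (a y) (b y) (rcnt r j.val))
    (fun j _ => wt_deriv a b z ha hb (rcnt r j.val))
  refine this.congr_deriv ?_
  refine Finset.sum_congr rfl fun p _ => ?_
  rw [← Finset.mul_prod_erase Finset.univ _ (Finset.mem_univ p)]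
  have : ∏ j ∈ Finset.univ.erase p, wt (a z) (b z) (rcnt r j.val + if p = j then 1 else 0)
      = ∏ j ∈ Finset.univ.erase p, wt (a z) (b z) (rcnt r j.val) := by
    refine Finset.prod_congr rfl fun j hj => ?_
    rw [if_neg (Finset.ne_of_mem_erase hj).symm, add_zero]
  rw [this]
  simp
  ring

lemma iter_WW (g a b : ℝ → ℝ) (S : Set ℝ) (hS : IsOpen S)
    (hg : ∀ z ∈ S, HasDerivAt g (a z) z)
    (ha : ∀ z ∈ S, HasDerivAt a (a z * b z) z)
    (hb : ∀ z ∈ S, HasDerivAt b (a z) z) (m : ℕ) :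
    ∀ z ∈ S, iteratedDeriv (m + 1) g z = WW (a z) (b z) m := by
  induction m with
  | zero =>
    intro z hz
    rw [zero_add, iteratedDeriv_one, (hg z hz).deriv]
    simp [WW, rcnt, wt]
  | succ m ih =>
    intro z hz
    rw [iteratedDeriv_succ]
    have : iteratedDeriv (m + 1) g =ᶠ[nhds z] fun y => WW (a y) (b y) m :=
      Filter.eventuallyEq_of_mem (hS.mem_nhds hz) ih
    rw [this.deriv_eq, (WW_deriv a b z (ha z hz) (hb z hz) m).deriv]

def toRec {m : ℕ} (t : IncTree (m + 1)) : RecT m :=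
  fun i => ⟨(t.val i.succ).val, by simpa using t.2.2.1 i.succ (by simp)⟩

lemma card_eq_rcnt {m : ℕ} (f : Fin (m + 1) → Fin (m + 1)) (r : RecT m)
    (h : ∀ i, (f i.succ).val = (r i).val) (j : Fin (m + 1)) :
    (Finset.univ.filter (fun i : Fin (m + 1) => i.val ≠ 0 ∧ f i = j)).card = rcnt r j.val := by
  rw [Finset.card_filter, Fin.sum_univ_succ]
  simp [rcnt, Fin.ext_iff, h]

lemma sum_incTree (x : ℝ) (m : ℕ) :
    ∑ t : IncTree (m + 1), x ^ numLeaves t = WW x 1 m := by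
  unfold WW
  refine Finset.sum_of_injOn toRec ?_ ?_ ?_ ?_
  · intro t _ t' _ h
    apply Subtype.ext
    funext i
    refine Fin.cases ?_ (fun i => ?_) i
    · rw [t.2.1 0 rfl, t'.2.1 0 rfl]
    · have := congrArg Fin.val (congrFun h i)
      exact Fin.ext this
  · intro t _; simp
  · intro r _ hr
    by_contra hne
    apply hr
    have hc : ∀ j : Fin (m + 1), rcnt r j.val ≤ 2 := by
      intro j
      by_contra hj
      apply hne
      apply Finset.prod_eq_zero (Finset.mem_univ j)
      simp only [wt]
      rw [if_neg (by omega), if_neg (by omega), if_neg (by omega)]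
    let f : Fin (m + 1) → Fin (m + 1) :=
      Fin.cases 0 (fun i => ⟨(r i).val, by have := (r i).isLt; have := i.isLt; omega⟩)
    have hf : ∀ i, (f i.succ).val = (r i).val := fun i => rfl
    refine ⟨⟨f, ?_, ?_, ?_⟩, by simp, ?_⟩
    · intro i hi
      have : i = 0 := Fin.ext hi
      subst this; rfl
    · intro i
      refine Fin.cases (by simp) (fun i _ => ?_) i
      rw [hf]; have := (r i).isLt; simpa using this
    · intro j
      rw [card_eq_rcnt f r hf]; exact hc j
    · funext i; rfl
  · intro t _
    have h1 : ∀ j, numChildren t j = rcnt (toRec t) j.val := fun j =>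
      card_eq_rcnt t.val (toRec t) (fun i => rfl) j
    have h2 : ∀ j, numChildren t j ≤ 2 := fun j => t.2.2.2 j
    unfold numLeaves
    rw [← Finset.prod_const, Finset.prod_filter]
    refine Finset.prod_congr rfl fun j _ => ?_
    rw [← h1]
    have := h2 j
    unfold wt
    split_ifs <;> first | rfl | omega

/-- For fixed `1/2 < x ≤ 1` and `s = √(2x − 1)`, the bivariate EGF
`Y(x,z) = Σ_{m ≥ 1} (Σ_{t ∈ I_m} x^{o t}) z^m / m!` converges for `z` small
enough, with sum `s / tan(arctan s − z·s/2) − 1`. -/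
theorem egf_incTree_leaves_tan (x : ℝ) (hx0 : 1 / 2 < x) (hx1 : x ≤ 1) :
    ∃ ε > 0, ∀ z : ℝ, |z| < ε →
      Real.tan (Real.arctan (Real.sqrt (2 * x - 1))
          - z * Real.sqrt (2 * x - 1) / 2) ≠ 0 ∧
      HasSum (fun m : ℕ =>
          (∑ t : IncTree (m + 1), x ^ numLeaves t) * z ^ (m + 1) /
            (Nat.factorial (m + 1)))
        (Real.sqrt (2 * x - 1) /
            Real.tan (Real.arctan (Real.sqrt (2 * x - 1))
              - z * Real.sqrt (2 * x - 1) / 2) - 1) := by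
  have hs2 : 0 < 2 * x - 1 := by linarith
  obtain ⟨s, hs⟩ : ∃ s, s = Real.sqrt (2 * x - 1) := ⟨_, rfl⟩
  have hspos : 0 < s := hs ▸ Real.sqrt_pos.2 hs2
  have hssq : s ^ 2 = 2 * x - 1 := hs ▸ Real.sq_sqrt hs2.le
  rw [← hs]
  obtain ⟨θ, hθ⟩ : ∃ θ, θ = Real.arctan s := ⟨_, rfl⟩
  have htan : Real.tan θ = s := by rw [hθ, Real.tan_arctan]
  have hθ0 : 0 < θ := hθ ▸ Real.arctan_pos.2 hspos
  have hθ1 : θ < π / 2 := hθ ▸ Real.arctan_lt_pi_div_two s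
  rw [← hθ]
  have hsin : 0 < Real.sin θ := Real.sin_pos_of_pos_of_lt_pi hθ0 (by linarith [Real.pi_pos])
  have hcos : 0 < Real.cos θ := Real.cos_pos_of_mem_Ioo ⟨by linarith, hθ1⟩
  have hsc : Real.sin θ = s * Real.cos θ := by
    rw [← htan, Real.tan_mul_cos hcos.ne']
  let u : ℝ → ℝ := fun z => θ - z * s / 2
  let b : ℝ → ℝ := fun z => s * Real.cos (u z) / Real.sin (u z)
  let a : ℝ → ℝ := fun z => s ^ 2 / 2 / Real.sin (u z) ^ 2
  let g : ℝ → ℝ := fun z => b z - 1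
  have hu0 : u 0 = θ := by simp [u]
  have hu : ∀ z, HasDerivAt u (-(s / 2)) z := by
    intro z
    have := (((hasDerivAt_id z).mul_const s).div_const 2).const_sub θ
    simpa [u] using this
  have huc : Continuous u := by fun_prop
  have hS : IsOpen {z | Real.sin (u z) ≠ 0} :=
    isOpen_ne_fun (by fun_prop) continuous_const
  have hb : ∀ z ∈ {z | Real.sin (u z) ≠ 0}, HasDerivAt b (a z) z := by
    intro z hz
    have hz : Real.sin (u z) ≠ 0 := hz
    refine ((((hu z).cos).const_mul s).div (hu z).sin hz).congr_deriv ?_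
    simp only [a]
    field_simp
    linear_combination Real.sin_sq_add_cos_sq (u z)
  have ha : ∀ z ∈ {z | Real.sin (u z) ≠ 0}, HasDerivAt a (a z * b z) z := by
    intro z hz
    have hz : Real.sin (u z) ≠ 0 := hz
    refine ((hasDerivAt_const z (s^2/2)).div ((hu z).sin.pow 2) (pow_ne_zero 2 hz)).congr_deriv ?_
    simp only [a, b]
    field_simp
    simp
    try ring
  have hg : ∀ z ∈ {z | Real.sin (u z) ≠ 0}, HasDerivAt g (a z) z := fun z hz =>
    (hb z hz).sub_const 1
  have h0 : (0:ℝ) ∈ {z | Real.sin (u z) ≠ 0} := by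
    simp only [Set.mem_ofPred_eq, hu0]; exact hsin.ne'
  have hb0 : b 0 = 1 := by
    simp only [b, hu0]; rw [hsc]; field_simp
  have ha0 : a 0 = x := by
    simp only [a, hu0]
    have h := Real.sin_sq_add_cos_sq θ
    rw [hsc] at h ⊢
    field_simp
    linear_combination Real.cos θ ^ 2 * hssq - h
  have hit : ∀ m : ℕ, iteratedDeriv (m + 1) g 0 = ∑ t : IncTree (m + 1), x ^ numLeaves t := by
    intro m
    rw [iter_WW g a b _ hS hg ha hb m 0 h0, ha0, hb0, sum_incTree]
  have hua : AnalyticAt ℝ u 0 := by fun_prop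
  have hga : AnalyticAt ℝ g 0 := by
    refine AnalyticAt.sub (AnalyticAt.div (AnalyticAt.mul analyticAt_const ?_) ?_ h0)
      analyticAt_const
    · exact AnalyticAt.fun_comp Real.analyticAt_cos hua
    · exact AnalyticAt.fun_comp Real.analyticAt_sin hua
  have hsum := hga.hasFPowerSeriesAt.eventually_hasSum
  have hne : ∀ᶠ z in nhds (0:ℝ), u z ∈ Set.Ioo 0 (π / 2) :=
    huc.continuousAt.eventually_mem (Ioo_mem_nhds (by rw [hu0]; exact hθ0) (by rw [hu0]; exact hθ1))
  obtain ⟨ε, hε, H⟩ := Metric.eventually_nhds_iff.1 (hsum.and hne)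
  refine ⟨ε, hε, fun z hz => ?_⟩
  obtain ⟨h1, h2, h3⟩ := H (y := z) (by simpa using hz)
  refine ⟨(Real.tan_pos_of_pos_of_lt_pi_div_two h2 h3).ne', ?_⟩
  have hgz : s / Real.tan (θ - z * s / 2) - 1 = g z := by
    simp only [g, b, u]
    rw [Real.tan_eq_sin_div_cos, div_div_eq_mul_div]
  rw [hgz]
  have h4 := (hasSum_nat_add_iff' 1).2 h1
  have hg0 : g 0 = 0 := by simp [g, hb0]
  simp only [FormalMultilinearSeries.ofScalars_apply_eq, Finset.sum_range_one, hit,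
    iteratedDeriv_zero, hg0, zero_add, zero_div, zero_mul, sub_zero, smul_eq_mul] at h4
  have h5 : (fun m : ℕ => (∑ t : IncTree (m + 1), x ^ numLeaves t) * z ^ (m + 1) /
        ((Nat.factorial (m + 1) : ℕ) : ℝ)) = fun m : ℕ =>
      (∑ t : IncTree (m + 1), x ^ numLeaves t) / ((Nat.factorial (m + 1) : ℕ) : ℝ)
        * z ^ (m + 1) := by
    funext m
    ring
  rw [h5]
  exact h4
end

section
/- Fix a real number x with 0 < x < 1 and set s = √(1 − x). Then there exists ε > 0 such that for every real z with |z| < ε, the series Σ_{m ≥ 1} (Σ_{t ∈ I_m} 2^{m − o(t)} x^{o(t)}) z^{m+1} / m! converges and its sum equals (zx·e^{2zs} − zx) / ((s − 1)e^{2zs} + 1 + s). Consequently, the probability that a ranked tree of size n generated by the coalescent process has exactly o' cherries is the coefficient of x^{o'} z^n in the Taylor expansion of this function F(x,z) around z = 0. -/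
open Real

/-- Increasing parent functions without degree restriction. -/
abbrev IT (m : ℕ) : Type :=
  {f : Fin m → Fin m //
    (∀ i : Fin m, i.val = 0 → f i = i) ∧ (∀ i : Fin m, i.val ≠ 0 → (f i).val < i.val)}

def cc {m : ℕ} (f : Fin m → Fin m) (j : Fin m) : ℕ :=
  (Finset.univ.filter (fun i : Fin m => i.val ≠ 0 ∧ f i = j)).card

def extF {n : ℕ} (f : Fin (n+1) → Fin (n+1)) (p : Fin (n+1)) : Fin (n+2) → Fin (n+2) :=
  Fin.snoc (α := fun _ => Fin (n+2)) (fun i => (f i).castSucc) p.castSucc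

lemma extF_castSucc {n : ℕ} (f : Fin (n+1) → Fin (n+1)) (p i : Fin (n+1)) :
    extF f p i.castSucc = (f i).castSucc := by
  simp [extF]

lemma extF_last {n : ℕ} (f : Fin (n+1) → Fin (n+1)) (p : Fin (n+1)) :
    extF f p (Fin.last (n+1)) = p.castSucc := by
  simp [extF]

lemma cc_ext_castSucc {n : ℕ} (f : Fin (n+1) → Fin (n+1)) (p j : Fin (n+1)) :
    cc (extF f p) j.castSucc = cc f j + if p = j then 1 else 0 := by
  unfold cc
  rw [Finset.card_filter, Fin.sum_univ_castSucc, Finset.card_filter]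
  simp [extF_castSucc, extF_last]

lemma cc_ext_last {n : ℕ} (f : Fin (n+1) → Fin (n+1)) (p : Fin (n+1)) :
    cc (extF f p) (Fin.last (n+1)) = 0 := by
  unfold cc
  rw [Finset.card_filter, Fin.sum_univ_castSucc]
  simp [extF_castSucc, extF_last, Fin.castSucc_ne_last]

lemma IT_lt {n : ℕ} (g : IT (n+2)) (i : Fin (n+1)) : (g.1 i.castSucc).val < n + 1 := by
  by_cases h : i.val = 0
  · rw [g.2.1 i.castSucc h]; exact i.2
  · exact (g.2.2 i.castSucc h).trans i.2

lemma IT_lt_last {n : ℕ} (g : IT (n+2)) : (g.1 (Fin.last (n+1))).val < n + 1 :=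
  g.2.2 (Fin.last (n+1)) (by simp)

def ITequiv (n : ℕ) : IT (n+1) × Fin (n+1) ≃ IT (n+2) where
  toFun q := ⟨extF q.1.1 q.2, by
    constructor
    · intro i
      refine Fin.lastCases ?_ (fun i => ?_) i
      · intro h; simp at h
      · intro h; rw [extF_castSucc, q.1.2.1 i h]
    · intro i
      refine Fin.lastCases ?_ (fun i => ?_) i
      · intro _; rw [extF_last]; exact q.2.2
      · intro h; rw [extF_castSucc]; exact q.1.2.2 i h⟩
  invFun g := (⟨fun i => ⟨(g.1 i.castSucc).val, IT_lt g i⟩, by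
    constructor
    · intro i h
      apply Fin.ext
      have := congrArg Fin.val (g.2.1 i.castSucc h)
      exact this
    · intro i h
      exact g.2.2 i.castSucc h⟩, ⟨(g.1 (Fin.last (n+1))).val, IT_lt_last g⟩)
  left_inv q := by
    ext <;> simp [extF_castSucc, extF_last]
  right_inv g := by
    apply Subtype.ext
    funext i
    refine Fin.lastCases ?_ (fun i => ?_) i
    · simp only [extF_last]; ext; simp
    · simp only [extF_castSucc]; ext; simp

def SS (φ : ℕ → ℝ → ℝ) (m : ℕ) (z : ℝ) : ℝ := ∑ f : IT m, ∏ j, φ (cc f.1 j) z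

lemma SS_one (φ : ℕ → ℝ → ℝ) (z : ℝ) : SS φ 1 z = φ 0 z := by
  unfold SS
  have : Unique (IT 1) :=
    ⟨⟨⟨id, by simp, by intro i h; exact absurd (by omega) h⟩⟩, fun a => Subsingleton.elim _ _⟩
  rw [Fintype.sum_unique]
  simp [cc]

lemma SS_deriv (φ : ℕ → ℝ → ℝ) (z : ℝ)
    (h : ∀ k, HasDerivAt (φ k) (φ (k+1) z * φ 0 z) z) (n : ℕ) :
    HasDerivAt (SS φ (n+1)) (SS φ (n+2) z) z := by
  have h1 : HasDerivAt (fun z => ∑ f : IT (n+1), ∏ j, φ (cc f.1 j) z)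
      (∑ f : IT (n+1), ∑ p : Fin (n+1), (∏ j ∈ Finset.univ.erase p, φ (cc f.1 j) z) •
        (φ (cc f.1 p + 1) z * φ 0 z)) z := by
    apply HasDerivAt.fun_sum
    intro f _
    apply HasDerivAt.fun_finsetProd
    intro j _
    exact h _
  refine HasDerivAt.congr_deriv h1 (Eq.symm ?_)
  unfold SS
  rw [← (ITequiv n).sum_comp, Fintype.sum_prod_type]
  refine Finset.sum_congr rfl fun f _ => Finset.sum_congr rfl fun p _ => ?_
  change ∏ j, φ (cc (extF f.1 p) j) z = _
  rw [Fin.prod_univ_castSucc, cc_ext_last]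
  simp only [cc_ext_castSucc]
  rw [← Finset.prod_erase_mul _ _ (Finset.mem_univ p), smul_eq_mul, ← mul_assoc]
  congr 2
  · refine Finset.prod_congr rfl fun j hj => ?_
    rw [if_neg (Finset.ne_of_mem_erase hj).symm, add_zero]
  · simp

lemma SS_zero (φ : ℕ → ℝ → ℝ) (x : ℝ) (h0 : φ 0 0 = x) (h1 : φ 1 0 = 2) (h2 : φ 2 0 = 2)
    (h3 : ∀ k, φ (k+3) 0 = 0) (m : ℕ) :
    ∑ t : IncTree m, (2 : ℝ) ^ (m - numLeaves t) * x ^ numLeaves t = SS φ m 0 := by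
  unfold SS
  refine Finset.sum_of_injOn (fun t => ⟨t.1, t.2.1, t.2.2.1⟩) ?_ ?_ ?_ ?_
  · intro a _ b _ hab
    apply Subtype.ext
    exact congrArg (fun t : IT m => t.1) hab
  · intro a _; simp
  · intro f _ hf
    have : ∃ j, 2 < cc f.1 j := by
      by_contra! hc
      exact hf ⟨⟨f.1, f.2.1, f.2.2, hc⟩, by simp, rfl⟩
    obtain ⟨j, hj⟩ := this
    apply Finset.prod_eq_zero (Finset.mem_univ j)
    obtain ⟨k, hk⟩ := Nat.exists_eq_add_of_lt hj
    rw [hk, show 2 + k + 1 = k + 3 by ring]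
    exact h3 k
  · intro t _
    have key : ∀ j, φ (cc t.1 j) 0 = if numChildren t j = 0 then x else 2 := by
      intro j
      have h : cc t.1 j ≤ 2 := t.2.2.2 j
      change φ (cc t.1 j) 0 = if cc t.1 j = 0 then x else 2
      generalize cc t.1 j = c at h
      interval_cases c <;> simp [h0, h1, h2]
    simp only [key]
    rw [Finset.prod_ite, Finset.prod_const, Finset.prod_const, mul_comm]
    have := Finset.card_filter_add_card_filter_not (s := (Finset.univ : Finset (Fin m)))
      (fun j => numChildren t j = 0)
    rw [Finset.card_univ, Fintype.card_fin] at this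
    unfold numLeaves
    congr 2
    omega

/-- For fixed `0 < x < 1` and `s = √(1 − x)`, the probability-weighted
generating function of ranked trees by size and number of cherries,
`F(x,z) = Σ_{m ≥ 1} (Σ_{t ∈ I_m} 2^{m − o t} x^{o t}) z^{m+1} / m!`,
converges for `z` small enough, with sum
`(zx·e^{2zs} − zx)/((s − 1)e^{2zs} + 1 + s)`. -/
theorem weighted_gf_cherries (x : ℝ) (hx0 : 0 < x) (hx1 : x < 1) :
    ∃ ε > 0, ∀ z : ℝ, |z| < ε →
      HasSum (fun m : ℕ =>
          (∑ t : IncTree (m + 1),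
              (2 : ℝ) ^ (m + 1 - numLeaves t) * x ^ numLeaves t)
            * z ^ (m + 2) / (Nat.factorial (m + 1)))
        ((z * x * Real.exp (2 * z * Real.sqrt (1 - x)) - z * x) /
          ((Real.sqrt (1 - x) - 1) * Real.exp (2 * z * Real.sqrt (1 - x))
            + 1 + Real.sqrt (1 - x))) := by
  set s := Real.sqrt (1 - x) with hs
  have hs2 : s ^ 2 = 1 - x := Real.sq_sqrt (by linarith)
  have hspos : 0 < s := Real.sqrt_pos.2 (by linarith)
  let D : ℝ → ℝ := fun z => (s - 1) * Real.exp (2 * z * s) + 1 + s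
  let y : ℝ → ℝ := fun z => (x * Real.exp (2 * z * s) - x) / D z
  have hD0 : D 0 ≠ 0 := by
    simp only [D, mul_zero, zero_mul, Real.exp_zero]
    intro h; linarith
  have hDc : Continuous D := by fun_prop
  have hDe : ∀ᶠ z in nhds (0:ℝ), D z ≠ 0 := hDc.continuousAt.eventually_ne hD0
  have hy0 : y 0 = 0 := by simp [y]
  have hE : ∀ z, HasDerivAt (fun z : ℝ => Real.exp (2 * z * s))
      (Real.exp (2 * z * s) * (2 * s)) z := by
    intro z
    have : HasDerivAt (fun z : ℝ => 2 * z * s) (2 * s) z := by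
      simpa using ((hasDerivAt_id z).const_mul 2).mul_const s
    exact this.exp
  have hy : ∀ z, D z ≠ 0 → HasDerivAt y (x + 2 * y z + y z ^ 2) z := by
    intro z hz
    have hN := ((hE z).const_mul x).sub_const x
    have hDd := (((hE z).const_mul (s-1)).add_const 1).add_const s
    refine (hN.fun_div hDd hz).congr_deriv ?_
    change (_ : ℝ) / (D z)^2 = x + 2 * ((x * Real.exp (2 * z * s) - x) / D z) +
      ((x * Real.exp (2 * z * s) - x) / D z)^2
    have hx : x = 1 - s^2 := by linarith
    field_simp
    simp only [D]
    rw [hx]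
    ring
  let φ : ℕ → ℝ → ℝ := fun k z =>
    match k with
    | 0 => x + 2 * y z + y z ^ 2
    | 1 => 2 + 2 * y z
    | 2 => 2
    | _ + 3 => 0
  have hφ : ∀ z, D z ≠ 0 → ∀ k, HasDerivAt (φ k) (φ (k+1) z * φ 0 z) z := by
    intro z hz k
    have h := hy z hz
    match k with
    | 0 =>
      refine (((h.const_mul 2).const_add x).add (h.pow 2)).congr_deriv ?_
      simp only [φ]; push_cast; ring
    | 1 =>
      exact (h.const_mul 2).const_add 2
    | 2 =>
      simpa [φ] using hasDerivAt_const z (2:ℝ)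
    | k + 3 =>
      simpa [φ] using hasDerivAt_const z (0:ℝ)
  have hit : ∀ m, iteratedDeriv (m+1) y =ᶠ[nhds 0] SS φ (m+1) := by
    intro m
    induction m with
    | zero =>
      filter_upwards [hDe] with z hz
      rw [zero_add, iteratedDeriv_one, SS_one, (hy z hz).deriv]
    | succ m ih =>
      rw [iteratedDeriv_succ]
      refine ih.deriv.trans ?_
      filter_upwards [hDe] with z hz
      exact (SS_deriv φ z (hφ z hz) m).deriv
  have han : AnalyticAt ℝ y 0 := by
    apply AnalyticAt.div _ _ hD0
    · fun_prop
    · fun_prop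
  have hps := han.hasFPowerSeriesAt
  obtain ⟨r, hr⟩ := hps
  obtain ⟨ε, hε, hεr⟩ := ENNReal.lt_iff_exists_nnreal_btwn.1 hr.r_pos
  refine ⟨ε, by exact_mod_cast hε, fun z hz => ?_⟩
  have hmem : z ∈ Metric.eball (0:ℝ) r := by
    rw [Metric.mem_eball, edist_zero_right]
    refine lt_trans ?_ hεr
    rw [← ofReal_norm, Real.norm_eq_abs]
    exact (ENNReal.ofReal_lt_coe_iff (abs_nonneg z)).2 hz
  have hsum := hr.hasSum hmem
  rw [zero_add] at hsum
  rw [← hasSum_nat_add_iff' 1] at hsum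
  have h2 := hsum.mul_left z
  convert h2 using 1
  · rfl
  · funext m
    rw [SS_zero φ x (by simp [φ, hy0]) (by simp [φ, hy0]) (by simp [φ]) (by simp [φ]) (m+1),
      ← (hit m).self_of_nhds]
    simp [FormalMultilinearSeries.ofScalars_apply_eq]
    ring
  · simp [FormalMultilinearSeries.ofScalars_apply_eq, hy0, y, D]
    ring
end
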